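/- Let S = {α + β : α, β short roots with (α,β) = 0}. Every dominant element of S is of the form θ_s + θ′ for some short root θ′ with (θ_s, θ′) = 0, where θ_s is the highest short root. -/

import Mathlib

open scoped RealInnerProductSpace

attribute [local instance] Classical.propDecidable

noncomputable section

/-- The reflection in the hyperplane orthogonal to `α`. -/
def sref {V : Type*} [NormedAddCommGroup V] [InnerProductSpace ℝ V] (α x : V) : V :=
  x - (2 * ⟪x, α⟫ / ⟪α, α⟫) • α

/-- The coroot `α^∨ = 2α/(α,α)`. -/
def coroot {V : Type*} [NormedAddCommGroup V] [InnerProductSpace ℝ V] (α : V) : V :=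
  (2 / ⟪α, α⟫) • α

/-- The data of a finite reduced irreducible crystallographic root system `R` in a real
inner product space, together with a fixed choice of positive roots and simple roots. -/
structure RSD (V : Type*) [NormedAddCommGroup V] [InnerProductSpace ℝ V] where
  R : Finset V
  Rpos : Finset V
  n : ℕ
  npos : 0 < n
  simple : Fin n → V
  simple_mem : ∀ i, simple i ∈ Rpos
  pos_sub : Rpos ⊆ R
  root_ne_zero : ∀ α ∈ R, α ≠ 0
  pos_or_neg : ∀ α ∈ R, α ∈ Rpos ∨ -α ∈ Rpos
  not_both : ∀ α ∈ Rpos, -α ∉ Rpos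
  pos_combo : ∀ α ∈ Rpos, ∃ c : Fin n → ℕ, α = ∑ i, (c i : ℝ) • simple i
  simple_indep : LinearIndependent ℝ simple
  reduced : ∀ α ∈ R, ∀ c : ℝ, c • α ∈ R → c = 1 ∨ c = -1
  crystal : ∀ α ∈ R, ∀ β ∈ R, ∃ k : ℤ, ⟪β, coroot α⟫ = (k : ℝ)
  refl_mem : ∀ α ∈ R, ∀ β ∈ R, sref α β ∈ R
  spanning : Submodule.span ℝ (R : Set V) = ⊤
  irred : ∀ s : Set V, (∀ α ∈ R, ∀ β ∈ R, α ∈ s → β ∉ s → ⟪α, β⟫ = 0) →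
    (∀ α ∈ R, α ∈ s) ∨ (∀ α ∈ R, α ∉ s)

namespace RSD

variable {V : Type*} [NormedAddCommGroup V] [InnerProductSpace ℝ V]

/-- The map of `V` determined by a word in the simple reflections. -/
def wordMap (S : RSD V) (l : List (Fin S.n)) : V → V :=
  l.foldr (fun i f => sref (S.simple i) ∘ f) id

/-- `w : V → V` is an element of the Weyl group `W`, i.e. a product of simple reflections. -/
def IsWeyl (S : RSD V) (w : V → V) : Prop := ∃ l : List (Fin S.n), w = S.wordMap l

/-- The length `ℓ(w)` of a Weyl group element: the smallest length of a word in the simple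
reflections representing `w`. -/
def len (S : RSD V) (w : V → V) : ℕ :=
  sInf {k | ∃ l : List (Fin S.n), l.length = k ∧ w = S.wordMap l}

/-- `x` and `y` lie in the same Weyl group orbit. -/
def sameOrbit (S : RSD V) (x y : V) : Prop := ∃ w, S.IsWeyl w ∧ w x = y

/-- `x` is dominant: `(x, α_i) ≥ 0` for all simple roots. -/
def Dominant (S : RSD V) (x : V) : Prop := ∀ i, 0 ≤ ⟪x, S.simple i⟫

/-- `w` is a Weyl group element of minimal length among those sending `x` to `y`. -/
def IsMinWord (S : RSD V) (x y : V) (w : V → V) : Prop :=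
  S.IsWeyl w ∧ w x = y ∧ ∀ w' : V → V, S.IsWeyl w' → w' x = y → S.len w ≤ S.len w'

/-- Membership in the root lattice `Q`, the ℤ-span of the simple roots. -/
def inQ (S : RSD V) (x : V) : Prop :=
  ∃ c : Fin S.n → ℤ, x = ∑ i, (c i : ℝ) • S.simple i

/-- The height `ht(λ) = Σ a_i` of an element `λ = Σ a_i α_i` of the root lattice
(the coefficients are unique since the simple roots are linearly independent). -/
def htZ (S : RSD V) (x : V) : ℤ :=
  if h : ∃ c : Fin S.n → ℤ, x = ∑ i, (c i : ℝ) • S.simple i then ∑ i, h.choose i else 0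

/-- The inversion set `Π(w) = {α ∈ R⁺ : w(α) ∈ R⁻}`. -/
def PiSet (S : RSD V) (w : V → V) : Finset V :=
  S.Rpos.filter (fun α => -(w α) ∈ S.Rpos)

/-- `α` is a short root (if all roots have the same length, all roots are short). -/
def IsShort (S : RSD V) (α : V) : Prop :=
  α ∈ S.R ∧ ∀ β ∈ S.R, ⟪α, α⟫ ≤ ⟪β, β⟫

/-- `α` is a long root. -/
def IsLong (S : RSD V) (α : V) : Prop :=
  α ∈ S.R ∧ ∀ β ∈ S.R, ⟪β, β⟫ ≤ ⟪α, α⟫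

/-- The short roots in the inversion set `Π(w)`. -/
def PiS (S : RSD V) (w : V → V) : Finset V :=
  (S.PiSet w).filter (fun α => S.IsShort α)

/-- The long roots in the inversion set `Π(w)`. -/
def PiL (S : RSD V) (w : V → V) : Finset V :=
  (S.PiSet w).filter (fun α => S.IsLong α)

end RSD


namespace RSD

variable {V : Type*} [NormedAddCommGroup V] [InnerProductSpace ℝ V]

lemma simple_mem_R (S : RSD V) (i : Fin S.n) : S.simple i ∈ S.R :=
  S.pos_sub (S.simple_mem i)

lemma inner_self_pos (S : RSD V) {α : V} (hα : α ∈ S.R) : 0 < ⟪α, α⟫ :=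
  real_inner_self_pos.2 (S.root_ne_zero α hα)

lemma inner_sref_self {α x : V} (hα : 0 < ⟪α, α⟫) : ⟪sref α x, α⟫ = -⟪x, α⟫ := by
  simp only [sref, inner_sub_left, real_inner_smul_left]
  field_simp
  ring

lemma inner_sref_sref {α x : V} (hα : 0 < ⟪α, α⟫) : ⟪sref α x, sref α x⟫ = ⟪x, x⟫ := by
  simp only [sref, inner_sub_left, inner_sub_right, real_inner_smul_left, real_inner_smul_right,
    real_inner_comm x α]
  field_simp
  ring

lemma neg_mem (S : RSD V) {α : V} (hα : α ∈ S.R) : -α ∈ S.R := by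
  have h := S.refl_mem α hα α hα
  have h0 := (S.inner_self_pos hα).ne'
  have : sref α α = -α := by
    rw [sref, mul_div_assoc, div_self h0, mul_one, two_smul]
    abel
  rwa [this] at h

lemma IsShort.neg {S : RSD V} {α : V} (hα : S.IsShort α) : S.IsShort (-α) :=
  ⟨S.neg_mem hα.1, fun β hβ => by rw [inner_neg_neg]; exact hα.2 β hβ⟩

lemma IsShort.sref {S : RSD V} {α x : V} (hα : α ∈ S.R) (hx : S.IsShort x) :
    S.IsShort (sref α x) :=
  ⟨S.refl_mem α hα x hx.1, fun β hβ => by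
    rw [inner_sref_sref (S.inner_self_pos hα)]; exact hx.2 β hβ⟩

lemma exists_int_two_mul_inner (S : RSD V) {α β : V} (hα : α ∈ S.R) (hβ : β ∈ S.R) :
    ∃ k : ℤ, 2 * ⟪β, α⟫ = k * ⟪α, α⟫ := by
  obtain ⟨k, hk⟩ := S.crystal α hα β hβ
  refine ⟨k, ?_⟩
  have h0 := (S.inner_self_pos hα).ne'
  rw [coroot, real_inner_smul_right] at hk
  field_simp at hk
  linarith

lemma IsShort.inner_self_eq {S : RSD V} {α β : V} (hα : S.IsShort α) (hβ : S.IsShort β) :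
    ⟪α, α⟫ = ⟪β, β⟫ :=
  le_antisymm (hα.2 β hβ.1) (hβ.2 α hα.1)

/-- Two short roots that are not orthogonal or at an obtuse angle are equal or at angle `π / 3`. -/
lemma IsShort.eq_or_two_mul_inner_eq {S : RSD V} {α β : V} (hα : S.IsShort α)
    (hβ : S.IsShort β) (h : 0 < ⟪α, β⟫) : α = β ∨ 2 * ⟪α, β⟫ = ⟪β, β⟫ := by
  obtain ⟨k, hk⟩ := S.exists_int_two_mul_inner hβ.1 hα.1
  have hN := S.inner_self_pos hβ.1
  have he := hα.inner_self_eq hβ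
  by_cases h2 : 2 ≤ k
  · left
    have h2' : (2 : ℝ) ≤ k := by exact_mod_cast h2
    have hle : ⟪α - β, α - β⟫ ≤ 0 := by
      rw [real_inner_sub_sub_self]
      nlinarith
    exact sub_eq_zero.1 (real_inner_self_nonpos.1 hle)
  · right
    have hk0 : 0 < k := by
      by_contra! hk0
      have hk0' : (k : ℝ) ≤ 0 := by exact_mod_cast hk0
      nlinarith
    obtain rfl : k = 1 := by omega
    simpa using hk

lemma IsShort.sub {S : RSD V} {α β : V} (hα : S.IsShort α) (hβ : S.IsShort β)
    (h : 2 * ⟪α, β⟫ = ⟪β, β⟫) : S.IsShort (α - β) := by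
  have := hα.sref hβ.1
  rwa [_root_.sref, h, div_self (S.inner_self_pos hβ.1).ne', one_smul] at this

/-- The reflection in a simple root `α_i` keeps a positive root that involves another simple root
positive, and only changes its `i`-th coefficient. -/
lemma exists_sref_eq_sum (S : RSD V) {c : Fin S.n → ℕ}
    (hc : ∑ l, (c l : ℝ) • S.simple l ∈ S.R) {i j : Fin S.n} (hij : j ≠ i) (hj : c j ≠ 0) :
    ∃ d : Fin S.n → ℕ,
      sref (S.simple i) (∑ l, (c l : ℝ) • S.simple l) = ∑ l, (d l : ℝ) • S.simple l ∧
      (d i : ℝ) = c i - 2 * ⟪∑ l, (c l : ℝ) • S.simple l, S.simple i⟫ /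
        ⟪S.simple i, S.simple i⟫ ∧
      ∀ l, l ≠ i → d l = c l := by
  set β := ∑ l, (c l : ℝ) • S.simple l with hβ
  set k := 2 * ⟪β, S.simple i⟫ / ⟪S.simple i, S.simple i⟫ with hk
  have hR := S.refl_mem _ (S.simple_mem_R i) β hc
  have hexp : sref (S.simple i) β =
      ∑ l, ((c l : ℝ) - if l = i then k else 0) • S.simple l := by
    rw [sref, ← hk, hβ]
    simp [sub_smul, Finset.sum_sub_distrib, ite_smul]
  have hinj : ∀ a b : Fin S.n → ℝ, ∑ l, a l • S.simple l = ∑ l, b l • S.simple l → a = b :=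
    fun a b h => S.simple_indep.fintypeLinearCombination_injective
      (by simpa [Fintype.linearCombination_apply] using h)
  rcases S.pos_or_neg _ hR with h | h
  · obtain ⟨d, hd⟩ := S.pos_combo _ h
    have := hinj _ _ (hd.symm.trans hexp)
    refine ⟨d, hd, by simpa using congrFun this i, fun l hl => ?_⟩
    simpa [hl] using congrFun this l
  · obtain ⟨d, hd⟩ := S.pos_combo _ h
    have h1 : ∑ l, (-(d l : ℝ)) • S.simple l = sref (S.simple i) β := by
      simp [neg_smul, ← hd]
    have h2 := congrFun (hinj _ _ (h1.trans hexp)) j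
    simp only [hij, if_false, sub_zero] at h2
    have : (0 : ℝ) < c j := by positivity
    have : (0 : ℝ) ≤ d j := by positivity
    linarith

lemma inner_simple_nonpos (S : RSD V) {i j : Fin S.n} (hij : i ≠ j) :
    ⟪S.simple i, S.simple j⟫ ≤ 0 := by
  have hs : ∑ l, ((Pi.single i 1 : Fin S.n → ℕ) l : ℝ) • S.simple l = S.simple i := by
    simp [Pi.single_apply, ite_smul]
  obtain ⟨d, -, hd, -⟩ := S.exists_sref_eq_sum (c := Pi.single i 1) (i := j) (j := i)
    (by rw [hs]; exact S.simple_mem_R i) hij (by simp)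
  rw [hs, Pi.single_eq_of_ne hij.symm] at hd
  have hN := S.inner_self_pos (S.simple_mem_R j)
  have h0 : (0 : ℝ) ≤ d j := by positivity
  by_contra! hpos
  have : 0 < 2 * ⟪S.simple i, S.simple j⟫ / ⟪S.simple j, S.simple j⟫ := by positivity
  simp only [Nat.cast_zero] at hd
  linarith

/-- If the simple roots are distributed over two orthogonal subspaces, so are all roots. -/
lemma mem_or_mem_of_isOrtho (S : RSD V) {P Q : Submodule ℝ V} (hPQ : P ⟂ Q)
    (hs : ∀ i, S.simple i ∈ P ∨ S.simple i ∈ Q) {α : V} (hα : α ∈ S.R) : α ∈ P ∨ α ∈ Q := by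
  have key : ∀ m : ℕ, ∀ c : Fin S.n → ℕ, ∑ l, c l = m → ∑ l, (c l : ℝ) • S.simple l ∈ S.R →
      ∑ l, (c l : ℝ) • S.simple l ∈ P ∨ ∑ l, (c l : ℝ) • S.simple l ∈ Q := by
    intro m
    induction m using Nat.strong_induction_on with
    | _ m ih =>
    intro c hm hc
    set β := ∑ l, (c l : ℝ) • S.simple l with hβ
    have hpos := S.inner_self_pos hc
    obtain ⟨i, hi⟩ : ∃ i, 0 < ⟪β, S.simple i⟫ := by
      by_contra! hle
      have : ⟪β, β⟫ ≤ 0 := by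
        nth_rw 2 [hβ]
        rw [inner_sum]
        refine Finset.sum_nonpos fun l _ => ?_
        rw [real_inner_smul_right]
        exact mul_nonpos_of_nonneg_of_nonpos (by positivity) (hle l)
      linarith
    have hN := S.inner_self_pos (S.simple_mem_R i)
    by_cases hj : ∃ j, j ≠ i ∧ c j ≠ 0
    · obtain ⟨j, hji, hj⟩ := hj
      obtain ⟨d, hd, hdi, hdl⟩ := S.exists_sref_eq_sum hc hji hj
      have hdlt : d i < c i := by
        have : 0 < 2 * ⟪β, S.simple i⟫ / ⟪S.simple i, S.simple i⟫ := by positivity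
        have : (d i : ℝ) < c i := by rw [hdi]; linarith
        exact_mod_cast this
      have hlt : ∑ l, d l < m := by
        rw [← hm]
        refine Finset.sum_lt_sum (fun l _ => ?_) ⟨i, Finset.mem_univ i, hdlt⟩
        by_cases hl : l = i
        · rw [hl]; exact hdlt.le
        · exact (hdl l hl).le
      have hmem := ih _ hlt d rfl (hd ▸ S.refl_mem _ (S.simple_mem_R i) β hc)
      rw [← hd] at hmem
      have hne : ⟪sref (S.simple i) β, S.simple i⟫ ≠ 0 := by
        rw [inner_sref_self hN]; linarith
      have hback : β = sref (S.simple i) β +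
          (2 * ⟪β, S.simple i⟫ / ⟪S.simple i, S.simple i⟫) • S.simple i := by
        rw [sref]; abel
      rcases hs i with hiP | hiQ <;> rcases hmem with hP | hQ
      · exact Or.inl (hback ▸ P.add_mem hP (P.smul_mem _ hiP))
      · exact absurd (hPQ.symm.inner_eq hQ hiP) hne
      · exact absurd (hPQ.inner_eq hP hiQ) hne
      · exact Or.inr (hback ▸ Q.add_mem hQ (Q.smul_mem _ hiQ))
    · push Not at hj
      have : β = (c i : ℝ) • S.simple i := by
        rw [hβ]
        exact Finset.sum_eq_single i (fun l _ hl => by simp [hj l hl]) (by simp)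
      rw [this]
      exact (hs i).imp (P.smul_mem _) (Q.smul_mem _)
  rcases S.pos_or_neg α hα with h | h
  · obtain ⟨c, hc⟩ := S.pos_combo α h
    rw [hc]
    exact key _ c rfl (hc ▸ hα)
  · obtain ⟨c, hc⟩ := S.pos_combo _ h
    rw [← P.neg_mem_iff, ← Q.neg_mem_iff, hc]
    exact key _ c rfl (hc ▸ S.pos_sub h)

lemma Dominant.inner_nonneg {S : RSD V} {x α : V} (hx : S.Dominant x) (hα : α ∈ S.Rpos) :
    0 ≤ ⟪x, α⟫ := by
  obtain ⟨c, rfl⟩ := S.pos_combo α hα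
  rw [inner_sum]
  refine Finset.sum_nonneg fun l _ => ?_
  rw [real_inner_smul_right]
  exact mul_nonneg (by positivity) (hx l)

lemma Dominant.mem_Rpos {S : RSD V} {θ : V} (hθ : S.Dominant θ) (h : θ ∈ S.R) : θ ∈ S.Rpos := by
  refine (S.pos_or_neg θ h).resolve_right fun hneg => ?_
  have h1 := hθ.inner_nonneg hneg
  have h2 := S.inner_self_pos h
  rw [inner_neg_right] at h1
  linarith

/-- Every simple root occurs in a dominant root. -/
lemma Dominant.coeff_ne_zero {S : RSD V} {c : Fin S.n → ℕ}
    (hdom : S.Dominant (∑ l, (c l : ℝ) • S.simple l))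
    (hR : ∑ l, (c l : ℝ) • S.simple l ∈ S.R) (i : Fin S.n) : c i ≠ 0 := by
  intro hi
  set θ := ∑ l, (c l : ℝ) • S.simple l with hθ
  set P : Submodule ℝ V := Submodule.span ℝ (S.simple '' {l | c l ≠ 0}) with hP
  have hperp : ∀ j, c j = 0 → S.simple j ∈ Pᗮ := by
    intro j hj
    have hterm : ∀ l ∈ Finset.univ, ⟪(c l : ℝ) • S.simple l, S.simple j⟫ ≤ 0 := by
      intro l _
      rw [real_inner_smul_left]
      by_cases hl : l = j
      · simp [hl, hj]
      · exact mul_nonpos_of_nonneg_of_nonpos (by positivity) (S.inner_simple_nonpos hl)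
    have hsum : ∑ l, ⟪(c l : ℝ) • S.simple l, S.simple j⟫ = 0 := by
      refine le_antisymm (Finset.sum_nonpos hterm) ?_
      rw [← sum_inner]
      exact hdom j
    have hzero := (Finset.sum_eq_zero_iff_of_nonpos hterm).1 hsum
    rw [Submodule.mem_orthogonal]
    intro u hu
    induction hu using Submodule.span_induction with
    | mem x hx =>
      obtain ⟨l, hl, rfl⟩ := hx
      have := hzero l (Finset.mem_univ l)
      rw [real_inner_smul_left] at this
      exact (mul_eq_zero.1 this).resolve_left (by exact_mod_cast hl)
    | zero => simp
    | add x y _ _ hx hy => rw [inner_add_left, hx, hy, add_zero]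
    | smul a x _ hx => rw [real_inner_smul_left, hx, mul_zero]
  have hmemP : ∀ j, c j ≠ 0 → S.simple j ∈ P := fun j hj =>
    Submodule.subset_span ⟨j, hj, rfl⟩
  have hθP : θ ∈ P := by
    refine P.sum_mem fun l _ => ?_
    by_cases hl : c l = 0
    · simp [hl]
    · exact P.smul_mem _ (hmemP l hl)
  have hor : ∀ α ∈ S.R, α ∈ P ∨ α ∈ Pᗮ := fun α hα =>
    S.mem_or_mem_of_isOrtho P.isOrtho_orthogonal_right
      (fun j => (em (c j = 0)).symm.imp (hmemP j) (hperp j)) hα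
  rcases S.irred P (fun α _ β hβ hαP hβP =>
    Submodule.inner_right_of_mem_orthogonal hαP ((hor β hβ).resolve_left hβP)) with h | h
  · have h0 := Submodule.inner_right_of_mem_orthogonal (h _ (S.simple_mem_R i)) (hperp i hi)
    exact (S.inner_self_pos (S.simple_mem_R i)).ne' h0
  · exact h θ hR hθP

lemma exists_inner_simple_ne_zero (S : RSD V) {γ : V} (hγ : γ ∈ S.R) :
    ∃ i, ⟪γ, S.simple i⟫ ≠ 0 := by
  by_contra! h
  have hs : ∀ α ∈ S.Rpos, ⟪γ, α⟫ = 0 := by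
    intro α hα
    obtain ⟨c, rfl⟩ := S.pos_combo α hα
    simp [inner_sum, real_inner_smul_right, h]
  have h0 := (S.inner_self_pos hγ).ne'
  rcases S.pos_or_neg γ hγ with hp | hp
  · exact h0 (hs γ hp)
  · exact h0 (by simpa using hs _ hp)

lemma Dominant.inner_pos {S : RSD V} {γ θ : V} (hγ : S.Dominant γ) (hγR : γ ∈ S.R)
    (hθ : S.Dominant θ) (hθR : θ ∈ S.R) : 0 < ⟪γ, θ⟫ := by
  obtain ⟨c, rfl⟩ := S.pos_combo θ (hθ.mem_Rpos hθR)
  obtain ⟨i, hi⟩ := S.exists_inner_simple_ne_zero hγR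
  have hci := hθ.coeff_ne_zero hθR i
  rw [inner_sum]
  simp only [real_inner_smul_right]
  refine Finset.sum_pos' (fun l _ => mul_nonneg (by positivity) (hγ l)) ⟨i, Finset.mem_univ i, ?_⟩
  exact mul_pos (by positivity) (lt_of_le_of_ne (hγ i) hi.symm)

/-- There is only one dominant short root. -/
lemma Dominant.eq_of_isShort {S : RSD V} {γ θ : V} (hγ : S.Dominant γ) (hγs : S.IsShort γ)
    (hθ : S.Dominant θ) (hθs : S.IsShort θ) : γ = θ := by
  have hpos := hγ.inner_pos hγs.1 hθ hθs.1
  refine (hγs.eq_or_two_mul_inner_eq hθs hpos).resolve_right fun h => ?_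
  have he := hγs.inner_self_eq hθs
  have hc := real_inner_comm γ θ
  rcases S.pos_or_neg _ (hγs.sub hθs h).1 with hp | hp
  · have := hθ.inner_nonneg hp
    rw [inner_sub_right] at this
    linarith
  · have := hγ.inner_nonneg hp
    rw [neg_sub, inner_sub_right] at this
    linarith

/-- A dominant short root maximizes the pairing with a dominant vector among the short roots. -/
lemma Dominant.inner_le_inner {S : RSD V} {μ θ α : V} (hμ : S.Dominant μ) (hθ : S.Dominant θ)
    (hθs : S.IsShort θ) (hα : S.IsShort α) : ⟪μ, α⟫ ≤ ⟪μ, θ⟫ := by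
  obtain ⟨f, hf⟩ : ∃ f : V →ₗ[ℝ] ℝ, ∀ i, f (S.simple i) = 1 := by
    obtain ⟨f, hf⟩ := LinearMap.exists_extend
      ((Module.Basis.span S.simple_indep).constr ℝ (fun _ => (1 : ℝ)))
    refine ⟨f, fun i => ?_⟩
    have h := LinearMap.congr_fun hf (Module.Basis.span S.simple_indep i)
    rw [Module.Basis.constr_basis] at h
    simpa [Module.Basis.span_apply] using h
  obtain ⟨γ, hγ, hmax⟩ := (S.R.filter S.IsShort).exists_max_image
    (fun x => toLex (⟪μ, x⟫, f x)) ⟨α, by simp [hα, hα.1]⟩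
  rw [Finset.mem_filter] at hγ
  have hle : ∀ x, S.IsShort x → ⟪μ, x⟫ < ⟪μ, γ⟫ ∨ ⟪μ, x⟫ = ⟪μ, γ⟫ ∧ f x ≤ f γ := fun x hx => by
    simpa [Prod.Lex.toLex_le_toLex] using hmax x (by simp [hx, hx.1])
  have hγdom : S.Dominant γ := by
    intro i
    by_contra! hneg
    have hN := S.inner_self_pos (S.simple_mem_R i)
    have hk : 2 * ⟪γ, S.simple i⟫ / ⟪S.simple i, S.simple i⟫ < 0 :=
      div_neg_of_neg_of_pos (by linarith) hN
    have h := hle _ (hγ.2.sref (S.simple_mem_R i))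
    simp only [sref, inner_sub_right, real_inner_smul_right, map_sub, map_smul, hf,
      smul_eq_mul, mul_one] at h
    have hprod := mul_nonpos_of_nonpos_of_nonneg hk.le (hμ i)
    rcases h with h | ⟨-, h⟩ <;> linarith
  rw [← hγdom.eq_of_isShort hγ.2 hθ hθs]
  exact (hle α hα).elim le_of_lt fun h => h.1.le

end RSD

/-- Let `S = {α + β : α, β short roots with (α, β) = 0}`. Every dominant
element of `S` has the form `θ_s + θ'` for some short root `θ'` orthogonal to the highest
short root `θ_s`. -/
theorem dominant_sum_of_orthogonal_short_roots
    {V : Type*} [NormedAddCommGroup V] [InnerProductSpace ℝ V]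
    (S : RSD V) (θs : V)
    (hθs : S.IsShort θs ∧ S.Dominant θs ∧ ∀ β : V, S.IsShort β → S.htZ β ≤ S.htZ θs)
    (μ : V) (hμ : ∃ α β : V, S.IsShort α ∧ S.IsShort β ∧ ⟪α, β⟫ = 0 ∧ μ = α + β)
    (hdom : S.Dominant μ) :
    ∃ θ' : V, S.IsShort θ' ∧ ⟪θs, θ'⟫ = 0 ∧ μ = θs + θ' := by
  obtain ⟨hs, hd, -⟩ := hθs
  obtain ⟨α, β, hα, hβ, hαβ, rfl⟩ := hμ
  have hle := hdom.inner_le_inner hd hs hα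
  have hN := S.inner_self_pos hs.1
  have hαs := hα.inner_self_eq hs
  have hβs := hβ.inner_self_eq hs
  have hcα := real_inner_comm θs α
  have hcβ := real_inner_comm θs β
  have hβα : ⟪β, α⟫ = 0 := by rw [real_inner_comm, hαβ]
  rw [inner_add_left, inner_add_left, hβα] at hle
  have hhalf : ∀ x, S.IsShort x → x ≠ θs → 2 * ⟪x, θs⟫ ≤ ⟪θs, θs⟫ := fun x hx hne => by
    rcases le_or_gt ⟪x, θs⟫ 0 with h | h
    · linarith
    · exact ((hx.eq_or_two_mul_inner_eq hs h).resolve_left hne).le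
  by_cases h1 : α = θs
  · exact ⟨β, hβ, h1 ▸ hαβ, by rw [h1]⟩
  by_cases h2 : β = θs
  · exact ⟨α, hα, h2 ▸ hβα, by rw [h2, add_comm]⟩
  have hα2 := hhalf α hα h1
  have hβ2 := hhalf β hβ h2
  have hshort : S.IsShort (β - (θs - α)) := by
    refine hβ.sub (hs.sub hα (by linarith)) ?_
    rw [real_inner_sub_sub_self, inner_sub_right]
    linarith
  refine ⟨β - (θs - α), hshort, ?_, by abel⟩
  rw [inner_sub_right, inner_sub_right]
  linarith

end
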